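/- arXiv:math-ph/0407023 — 2 statements merged into one kernel-verified Lean document; each statement's English description precedes it below -/
import Mathlib

section
/- Let R > 0 and let f^in : ℝ³×ℝ³ → [0,∞) be bounded and measurable with support contained in {(y,p) : |y| ≤ R, |p| ≤ R}, let φ₀^in ∈ C²(ℝ³) and φ₁^in ∈ C¹(ℝ³) be supported in the closed ball of radius R. Define, for t > 0 and x ∈ ℝ³, with ω := −(x−y)/|x−y| and p̂ := p/√(1+|p|²), D(t,x) := −(1/t)∫_{|x−y|=t} ∫_{ℝ³} f^in(y,p)/((1+ω·p̂)√(1+|p|²)) dp dS_y + (1/(4πt²))∫_{|x−y|=t} (φ₁^in(y) − ∇φ₁^in(y)·(x−y)) dS_y − (1/(4πt³))∫_{|x−y|=t} (2∇φ₀^in(y)·(x−y) − (D²φ₀^in(y)(x−y))·(x−y)) dS_y. Then there exists a constant C > 0, depending only on R and on the sup norms of f^in, φ₁^in, ∇φ₁^in, ∇φ₀^in and D²φ₀^in, such that |D(t,x)| ≤ C·(1+R+t+|x|)^{-1}·(1+R+t−|x|)^{-1} for all t > 0 and all x ∈ ℝ³ with |x| ≤ R + t. -/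
open MeasureTheory Real Filter
open scoped RealInnerProductSpace ENNReal

noncomputable section

/-- Physical/momentum space `ℝ³`, modelled as Euclidean space. -/
abbrev E3 := EuclideanSpace ℝ (Fin 3)

/-- `p̂ := p / √(1+|p|²)`. -/
def phat (p : E3) : E3 := (Real.sqrt (1 + ‖p‖ ^ 2))⁻¹ • p

/-- The `i`-th standard basis vector of `ℝ³`. -/
def e3 (i : Fin 3) : E3 := EuclideanSpace.single i 1

/-- Time derivative `∂ₜφ` of a field `φ(t,x)`. -/
def dt (φ : ℝ → E3 → ℝ) (t : ℝ) (x : E3) : ℝ := deriv (fun s => φ s x) t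

/-- Second time derivative `∂ₜ²φ`. -/
def dtt (φ : ℝ → E3 → ℝ) (t : ℝ) (x : E3) : ℝ := deriv (fun s => dt φ s x) t

/-- Spatial gradient `∇ₓφ`. -/
def gradx (φ : ℝ → E3 → ℝ) (t : ℝ) (x : E3) : E3 := gradient (φ t) x

/-- Spatial Laplacian `Δₓφ`. -/
def lapx (φ : ℝ → E3 → ℝ) (t : ℝ) (x : E3) : ℝ :=
  ∑ i : Fin 3, fderiv ℝ (fun x' => fderiv ℝ (φ t) x' (e3 i)) x (e3 i)

/-- The transport operator `S = ∂ₜ + p̂·∇ₓ` applied to a field `φ(t,x)`. -/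
def Sphi (φ : ℝ → E3 → ℝ) (p : E3) (t : ℝ) (x : E3) : ℝ :=
  dt φ t x + ⟪phat p, gradx φ t x⟫

/-- The transport operator `S = ∂ₜ + p̂·∇ₓ` applied to a density `f(t,x,p)`. -/
def Sf (f : ℝ → E3 → E3 → ℝ) (t : ℝ) (x : E3) (p : E3) : ℝ :=
  deriv (fun s => f s x p) t + ⟪phat p, gradient (fun x' => f t x' p) x⟫

/-- Divergence in the momentum variable `p` of a vector field on `ℝ³`. -/
def divP (V : E3 → E3) (p : E3) : ℝ :=
  ∑ i : Fin 3, fderiv ℝ (fun q => V q i) p (e3 i)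

/-- The vector field `G(t,x,p) = (Sφ)(t,x,p)·p + (1+|p|²)^{-1/2}·∇ₓφ(t,x)`. -/
def Gfield (φ : ℝ → E3 → ℝ) (t : ℝ) (x : E3) (q : E3) : E3 :=
  Sphi φ q t x • q + (Real.sqrt (1 + ‖q‖ ^ 2))⁻¹ • gradx φ t x

/-- `K(t,x) = |∂ₜφ(t,x)| + |∇ₓφ(t,x)|`: the size of the first-order derivatives. -/
def Kfun (φ : ℝ → E3 → ℝ) (t : ℝ) (x : E3) : ℝ := |dt φ t x| + ‖gradx φ t x‖

/-- `L(t,x)`: the sum of the absolute values of all second-order derivatives of `φ`. -/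
def Lfun (φ : ℝ → E3 → ℝ) (t : ℝ) (x : E3) : ℝ :=
  |dtt φ t x|
    + ∑ i : Fin 3, |deriv (fun s => fderiv ℝ (φ s) x (e3 i)) t|
    + ∑ i : Fin 3, ∑ j : Fin 3, |fderiv ℝ (fun x' => fderiv ℝ (φ t) x' (e3 i)) x (e3 j)|

/-- The data term `(∂ₜφ)_D` of the representation formula for `∂ₜφ`:
`D(t,x) = −(1/t)∫_{|x−y|=t}∫ f^in(y,p)/((1+ω·p̂)√(1+p²)) dp dS_y
  + (1/(4πt²))∫_{|x−y|=t}(φ₁^in(y) − ∇φ₁^in(y)·(x−y)) dS_y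
  − (1/(4πt³))∫_{|x−y|=t}(2∇φ₀^in(y)·(x−y) − (D²φ₀^in(y)(x−y))·(x−y)) dS_y`,
where `ω = −(x−y)/|x−y|` and the surface integrals are with respect to the
2-dimensional Hausdorff measure on the sphere `{y : |x−y| = t}`. -/
def Dfun (fin : E3 → E3 → ℝ) (φ0 φ1 : E3 → ℝ) (t : ℝ) (x : E3) : ℝ :=
  -(1 / t) * ∫ y in Metric.sphere x t,
      (∫ p : E3, fin y p /
        ((1 + ⟪‖x - y‖⁻¹ • (y - x), phat p⟫) * Real.sqrt (1 + ‖p‖ ^ 2))) ∂μH[2]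
  + (1 / (4 * π * t ^ 2)) * ∫ y in Metric.sphere x t,
      (φ1 y - ⟪gradient φ1 y, x - y⟫) ∂μH[2]
  - (1 / (4 * π * t ^ 3)) * ∫ y in Metric.sphere x t,
      (2 * ⟪gradient φ0 y, x - y⟫ - ⟪fderiv ℝ (gradient φ0) y (x - y), x - y⟫) ∂μH[2]

/-- The spherical cap facing the coordinate direction `σ i` has an injective projection onto the
remaining two coordinates, with Lipschitz inverse. -/
lemma dist_le_of_mem_sphere_patch {x y z : E3} {t σ : ℝ} (hσ : σ = 1 ∨ σ = -1) (i : Fin 3)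
    (hy : y ∈ Metric.sphere x t) (hz : z ∈ Metric.sphere x t)
    (hyi : ∀ j, |y j - x j| ≤ σ * (y i - x i)) (hzi : ∀ j, |z j - x j| ≤ σ * (z i - x i)) :
    dist y z ≤ 4 * dist (fun k : Fin 2 => y (i.succAbove k)) (fun k => z (i.succAbove k)) := by
  set d := dist (fun k : Fin 2 => y (i.succAbove k)) (fun k => z (i.succAbove k))
  have hd0 : 0 ≤ d := dist_nonneg
  have hk : ∀ k : Fin 2, |y (i.succAbove k) - z (i.succAbove k)| ≤ d := fun k => by
    simpa [Real.dist_eq] using dist_le_pi_dist (fun k : Fin 2 => y (i.succAbove k))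
      (fun k => z (i.succAbove k)) k
  have sq : ∀ w ∈ Metric.sphere x t, (w i - x i) ^ 2 + ((w (i.succAbove 0) - x (i.succAbove 0)) ^ 2
      + (w (i.succAbove 1) - x (i.succAbove 1)) ^ 2) = t ^ 2 := fun w hw => by
    rw [Metric.mem_sphere] at hw
    rw [← hw, EuclideanSpace.dist_sq_eq, Fin.sum_univ_succAbove _ i]
    simp [Real.dist_eq, sq_abs]
  have hi : |y i - z i| ≤ 2 * d := by
    have key : ∀ k : Fin 2, |(z (i.succAbove k) - x (i.succAbove k)) ^ 2
        - (y (i.succAbove k) - x (i.succAbove k)) ^ 2| ≤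
        d * (σ * (y i - x i) + σ * (z i - x i)) := fun k => by
      rw [sq_sub_sq, abs_mul, mul_comm]
      have h1 := abs_add_le (z (i.succAbove k) - x (i.succAbove k))
        (y (i.succAbove k) - x (i.succAbove k))
      have h2 := hk k
      rw [abs_sub_comm] at h2
      rw [show z (i.succAbove k) - x (i.succAbove k) - (y (i.succAbove k) - x (i.succAbove k))
        = z (i.succAbove k) - y (i.succAbove k) by ring]
      exact mul_le_mul h2 (by linarith [hyi (i.succAbove k), hzi (i.succAbove k)])
        (abs_nonneg _) hd0
    set m := σ * (y i - x i) + σ * (z i - x i) with hm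
    have hy0 := (abs_nonneg _).trans (hyi i)
    have hz0 := (abs_nonneg _).trans (hzi i)
    have hprod : |y i - z i| * m ≤ 2 * d * m := by
      have e : |y i - z i| * m = |(y i - x i) ^ 2 - (z i - x i) ^ 2| := by
        rw [← abs_of_nonneg (show 0 ≤ m by positivity), ← abs_mul]
        rcases hσ with rfl | rfl
        · congr 1; rw [hm]; ring
        · rw [← abs_neg]; congr 1; rw [hm]; ring
      have e2 : (y i - x i) ^ 2 - (z i - x i) ^ 2 =
          ((z (i.succAbove 0) - x (i.succAbove 0)) ^ 2
            - (y (i.succAbove 0) - x (i.succAbove 0)) ^ 2)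
          + ((z (i.succAbove 1) - x (i.succAbove 1)) ^ 2
            - (y (i.succAbove 1) - x (i.succAbove 1)) ^ 2) := by
        linarith [sq y hy, sq z hz]
      rw [e, e2]
      refine (abs_add_le _ _).trans ?_
      linarith [key 0, key 1]
    rcases (show 0 ≤ m by positivity).eq_or_lt with h0 | h0
    · have a : y i - x i = 0 := by
        have := hyi i
        rw [show σ * (y i - x i) = 0 by linarith] at this
        exact abs_nonpos_iff.1 this
      have b : z i - x i = 0 := by
        have := hzi i
        rw [show σ * (z i - x i) = 0 by linarith] at this
        exact abs_nonpos_iff.1 this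
      rw [show y i - z i = 0 by linarith, abs_zero]
      positivity
    · exact le_of_mul_le_mul_right hprod h0
  refine (sq_le_sq₀ dist_nonneg (by positivity)).1 ?_
  rw [EuclideanSpace.dist_sq_eq, Fin.sum_univ_succAbove _ i]
  simp only [Fin.sum_univ_two, Real.dist_eq]
  have s0 := pow_le_pow_left₀ (abs_nonneg _) hi 2
  have s1 := pow_le_pow_left₀ (abs_nonneg _) (hk 0) 2
  have s2 := pow_le_pow_left₀ (abs_nonneg _) (hk 1) 2
  nlinarith [sq_nonneg d]

lemma hausdorffMeasure_sphere_patch_le (x c : E3) (t r σ : ℝ) (hr : 0 ≤ r)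
    (hσ : σ = 1 ∨ σ = -1) (i : Fin 3) :
    μH[2] {y : E3 | y ∈ Metric.sphere x t ∩ Metric.closedBall c r ∧
      ∀ j, |y j - x j| ≤ σ * (y i - x i)} ≤ ENNReal.ofReal (64 * r ^ 2) := by
  set s := {y : E3 | y ∈ Metric.sphere x t ∩ Metric.closedBall c r ∧
      ∀ j, |y j - x j| ≤ σ * (y i - x i)}
  let f : s → (Fin 2 → ℝ) := fun y k => y.1 (i.succAbove k)
  have hf : AntilipschitzWith 4 f := AntilipschitzWith.of_le_mul_dist fun y z => by
    exact dist_le_of_mem_sphere_patch hσ i y.2.1.1 z.2.1.1 y.2.2 z.2.2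
  have h1 := hf.le_hausdorffMeasure_image (d := 2) (by norm_num) Set.univ
  have h2 : μH[2] (Set.univ : Set s) = μH[2] s := by
    rw [← isometry_subtype_coe.hausdorffMeasure_image (Or.inl (by norm_num)), Set.image_univ,
      Subtype.range_coe]
  have h3 : (μH[2] : Measure (Fin 2 → ℝ)) = volume := by
    have := hausdorffMeasure_pi_real (ι := Fin 2)
    simpa using this
  have h4 : f '' Set.univ ⊆ Metric.closedBall (fun k => c (i.succAbove k)) r := by
    rintro _ ⟨y, -, rfl⟩
    rw [Metric.mem_closedBall, dist_pi_le_iff hr]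
    intro k
    refine le_trans ?_ (Metric.mem_closedBall.1 y.2.1.2)
    have := PiLp.norm_apply_le (y.1 - c) (i.succAbove k)
    simpa [dist_eq_norm, f] using this
  rw [h2, h3] at h1
  refine h1.trans ((mul_le_mul_right (measure_mono h4) _).trans ?_)
  rw [Real.volume_pi_closedBall _ hr]
  have : ((4 : NNReal) : ℝ≥0∞) ^ (2 : ℝ) = ENNReal.ofReal 16 := by
    rw [← ENNReal.coe_rpow_of_nonneg _ (by norm_num)]
    norm_num [ENNReal.ofReal]
  rw [this, ← ENNReal.ofReal_mul (by norm_num)]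
  apply ENNReal.ofReal_le_ofReal
  simp only [Fintype.card_fin]
  linarith [sq_nonneg r]

lemma hausdorffMeasure_sphere_inter_closedBall_le (x c : E3) (t r : ℝ) (hr : 0 ≤ r) :
    μH[2] (Metric.sphere x t ∩ Metric.closedBall c r) ≤ ENNReal.ofReal (384 * r ^ 2) := by
  let P : Fin 3 → ℝ → Set E3 := fun i σ =>
    {y : E3 | y ∈ Metric.sphere x t ∩ Metric.closedBall c r ∧
      ∀ j, |y j - x j| ≤ σ * (y i - x i)}
  have hsub : Metric.sphere x t ∩ Metric.closedBall c r ⊆ ⋃ i, (P i 1 ∪ P i (-1)) := by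
    intro y hy
    obtain ⟨i, -, hi⟩ := Finset.exists_max_image Finset.univ (fun j : Fin 3 => |y j - x j|)
      Finset.univ_nonempty
    refine Set.mem_iUnion.2 ⟨i, ?_⟩
    rcases abs_choice (y i - x i) with h | h
    · exact Or.inl ⟨hy, fun j => by linarith [hi j (Finset.mem_univ j)]⟩
    · exact Or.inr ⟨hy, fun j => by linarith [hi j (Finset.mem_univ j)]⟩
  have hP : ∀ i, μH[2] (P i 1 ∪ P i (-1)) ≤ ENNReal.ofReal (128 * r ^ 2) := fun i => by
    refine (measure_union_le _ _).trans ((add_le_add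
      (hausdorffMeasure_sphere_patch_le x c t r 1 hr (Or.inl rfl) i)
      (hausdorffMeasure_sphere_patch_le x c t r (-1) hr (Or.inr rfl) i)).trans ?_)
    rw [← ENNReal.ofReal_add (by positivity) (by positivity)]
    exact ENNReal.ofReal_le_ofReal (by linarith)
  refine (measure_mono hsub).trans ((measure_iUnion_fintype_le _ _).trans
    ((Finset.sum_le_sum fun i _ => hP i).trans ?_))
  rw [← ENNReal.ofReal_sum_of_nonneg fun _ _ => by positivity]
  apply ENNReal.ofReal_le_ofReal
  simp only [Finset.sum_const, Finset.card_univ, Fintype.card_fin, nsmul_eq_mul]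
  push_cast
  linarith

/-- A set integral of a function bounded by `M` and vanishing off `K`; no integrability needed. -/
lemma norm_setIntegral_le_of_eq_zero_off {α : Type*} [MeasurableSpace α] {μ : Measure α}
    {g : α → ℝ} {M : ℝ} {s K : Set α} (hs : MeasurableSet s) (hfin : μ (s ∩ K) < ∞)
    (hM : ∀ y ∈ s, |g y| ≤ M) (h0 : ∀ y ∉ K, g y = 0) :
    |∫ y in s, g y ∂μ| ≤ M * μ.real (s ∩ K) := by
  rw [setIntegral_eq_of_subset_of_forall_sdiff_eq_zero hs Set.inter_subset_left
    fun y hy => h0 y fun hK => hy.2 ⟨hy.1, hK⟩]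
  exact norm_setIntegral_le_of_norm_le_const (f := g) hfin fun y hy => hM y hy.1

lemma abs_momentum_integral_le {R B : ℝ} (hR : 0 < R) (hB : 0 < B) {h : E3 → ℝ}
    (hnn : ∀ p, 0 ≤ h p) (hle : ∀ p, h p ≤ B) (hsupp : ∀ p, h p ≠ 0 → ‖p‖ ≤ R)
    {u : E3} (hu : ‖u‖ ≤ 1) :
    |∫ p : E3, h p / ((1 + ⟪u, phat p⟫) * Real.sqrt (1 + ‖p‖ ^ 2))| ≤
      B * (1 + 2 * R) * volume.real (Metric.closedBall (0 : E3) R) := by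
  have h0 : ∀ p : E3, p ∉ Metric.closedBall (0 : E3) R → h p = 0 := fun p hp => by
    by_contra hne
    exact hp (mem_closedBall_zero_iff.2 (hsupp p hne))
  have key := norm_setIntegral_le_of_eq_zero_off (μ := (volume : Measure E3)) (s := Set.univ)
    (K := Metric.closedBall (0 : E3) R) (M := B * (1 + 2 * R))
    (g := fun p => h p / ((1 + ⟪u, phat p⟫) * Real.sqrt (1 + ‖p‖ ^ 2))) MeasurableSet.univ
    (by rw [Set.univ_inter]; exact measure_closedBall_lt_top) ?_ fun p hp => by simp [h0 p hp]
  · simpa using key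
  intro p _
  by_cases hp : h p = 0
  · simp only [hp, zero_div, abs_zero]; positivity
  have hpR := hsupp p hp
  set q := Real.sqrt (1 + ‖p‖ ^ 2) with hq
  have hq2 : q ^ 2 = 1 + ‖p‖ ^ 2 := Real.sq_sqrt (by positivity)
  have hq0 : 0 < q := Real.sqrt_pos.2 (by positivity)
  have hn := norm_nonneg p
  have hqle : q ≤ 1 + ‖p‖ := abs_le_of_sq_le_sq' (by nlinarith) (by positivity) |>.2
  have hinner : -‖p‖ ≤ ⟪u, p⟫ := by
    have := neg_le_of_abs_le (abs_real_inner_le_norm u p)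
    nlinarith
  have hden : (1 + ⟪u, phat p⟫) * q = q + ⟪u, p⟫ := by
    rw [phat, inner_smul_right, ← hq]
    field_simp
  have hgt : ‖p‖ < q := by nlinarith
  have hlow : 1 ≤ (q + ⟪u, p⟫) * (1 + 2 * R) := by
    have : 1 = (q - ‖p‖) * (q + ‖p‖) := by linarith
    rw [this]
    exact mul_le_mul (by linarith) (by linarith) (by positivity) (by linarith)
  rw [hden, abs_of_nonneg (div_nonneg (hnn p) (by linarith)), div_le_iff₀ (by linarith)]
  nlinarith [hle p]

lemma gradient_eq_zero_of_norm_gt {φ : E3 → ℝ} {R : ℝ} (h : ∀ y, φ y ≠ 0 → ‖y‖ ≤ R)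
    {y : E3} (hy : R < ‖y‖) : gradient φ y = 0 := by
  have : φ =ᶠ[nhds y] fun _ => 0 := by
    filter_upwards [continuous_norm.continuousAt.eventually (lt_mem_nhds hy)] with z hz
    by_contra hne
    exact absurd (h z hne) (not_le.2 hz)
  simp [gradient, this.fderiv_eq]

lemma fderiv_gradient_eq_zero_of_norm_gt {φ : E3 → ℝ} {R : ℝ} (h : ∀ y, φ y ≠ 0 → ‖y‖ ≤ R)
    {y : E3} (hy : R < ‖y‖) : fderiv ℝ (gradient φ) y = 0 := by
  have : gradient φ =ᶠ[nhds y] fun _ => 0 := by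
    filter_upwards [continuous_norm.continuousAt.eventually (lt_mem_nhds hy)] with z hz
    exact gradient_eq_zero_of_norm_gt h hz
  simp [this.fderiv_eq]

/-- decay of the data term.  There is a constant `C > 0`, depending
only on `R` and on the bound `B` for `f^in, φ₁^in, ∇φ₁^in, ∇φ₀^in, D²φ₀^in`, such that
`|D(t,x)| ≤ C·(1+R+t+|x|)⁻¹·(1+R+t−|x|)⁻¹` for all `t > 0` and `|x| ≤ R + t`. -/
theorem stmt2 (R B : ℝ) (hR : 0 < R) (hB : 0 < B) :
    ∃ C : ℝ, 0 < C ∧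
      ∀ (fin : E3 → E3 → ℝ) (φ0 φ1 : E3 → ℝ),
        -- `f^in` bounded, measurable, nonnegative, supported in `|y| ≤ R, |p| ≤ R`
        Measurable (fun q : E3 × E3 => fin q.1 q.2) →
        (∀ (y p : E3), 0 ≤ fin y p) →
        (∀ (y p : E3), fin y p ≤ B) →
        (∀ (y p : E3), fin y p ≠ 0 → ‖y‖ ≤ R ∧ ‖p‖ ≤ R) →
        -- `φ₀^in ∈ C²`, `φ₁^in ∈ C¹`, supported in the closed ball of radius `R`
        ContDiff ℝ 2 φ0 →
        ContDiff ℝ 1 φ1 →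
        (∀ y : E3, φ0 y ≠ 0 → ‖y‖ ≤ R) →
        (∀ y : E3, φ1 y ≠ 0 → ‖y‖ ≤ R) →
        -- sup-norm bounds on the data entering `Dfun`
        (∀ y : E3, |φ1 y| ≤ B) →
        (∀ y : E3, ‖gradient φ1 y‖ ≤ B) →
        (∀ y : E3, ‖gradient φ0 y‖ ≤ B) →
        (∀ y : E3, ‖fderiv ℝ (gradient φ0) y‖ ≤ B) →
        -- conclusion
        ∀ t : ℝ, 0 < t → ∀ x : E3, ‖x‖ ≤ R + t →
          |Dfun fin φ0 φ1 t x| ≤ C * (1 + R + t + ‖x‖)⁻¹ * (1 + R + t - ‖x‖)⁻¹ := by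
  set M := B * (1 + 2 * R) * volume.real (Metric.closedBall (0 : E3) R)
  have hM0 : 0 ≤ M := by positivity
  refine ⟨(M + 4 * B) * (768 * (1 + R ^ 2)) * (2 * (1 + R) * (1 + 2 * R)), by positivity, ?_⟩
  intro fin φ0 φ1 _ hnn hle hsupp _ _ hs0 hs1 hb1 hg1 hg0 hH0 t ht x hx
  set S := Metric.sphere x t
  set K := Metric.closedBall (0 : E3) R
  set A := (μH[2] : Measure E3).real (S ∩ K)
  have hmeas : MeasurableSet S := Metric.isClosed_sphere.measurableSet
  have hKm := hausdorffMeasure_sphere_inter_closedBall_le x 0 t R hR.le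
  have hSm : μH[2] (S ∩ K) ≤ ENNReal.ofReal (384 * t ^ 2) :=
    (measure_mono (Set.subset_inter Set.inter_subset_left
      (Set.inter_subset_left.trans Metric.sphere_subset_closedBall))).trans
      (hausdorffMeasure_sphere_inter_closedBall_le x x t t ht.le)
  have hfin : μH[2] (S ∩ K) < ∞ := hKm.trans_lt ENNReal.ofReal_lt_top
  have hA0 : 0 ≤ A := measureReal_nonneg
  have hAR : A ≤ 384 * R ^ 2 := ENNReal.toReal_le_of_le_ofReal (by positivity) hKm
  have hAt : A ≤ 384 * t ^ 2 := ENNReal.toReal_le_of_le_ofReal (by positivity) hSm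
  have hout : ∀ y, y ∉ K → R < ‖y‖ := fun y hy => by simpa [K] using hy
  have hnorm : ∀ y ∈ S, ‖x - y‖ = t := fun y hy => by
    rw [← dist_eq_norm, dist_comm]; exact hy
  have hvan : ∀ {φ : E3 → ℝ}, (∀ y, φ y ≠ 0 → ‖y‖ ≤ R) → ∀ y, R < ‖y‖ → φ y = 0 :=
    fun h y hy => by
      by_contra hne
      exact absurd (h y hne) (not_le.2 hy)
  have I1 : |∫ y in S, (∫ p : E3, fin y p /
        ((1 + ⟪‖x - y‖⁻¹ • (y - x), phat p⟫) * Real.sqrt (1 + ‖p‖ ^ 2))) ∂μH[2]| ≤ M * A := by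
    refine norm_setIntegral_le_of_eq_zero_off hmeas hfin (fun y hy => ?_) fun y hy => ?_
    · refine abs_momentum_integral_le hR hB (hnn y) (hle y) (fun p hp => (hsupp y p hp).2) ?_
      rw [norm_smul, norm_inv, norm_norm, norm_sub_rev y x, hnorm y hy, inv_mul_cancel₀ ht.ne']
    · have : ∀ p, fin y p = 0 := fun p => by
        by_contra hne
        exact absurd (hsupp y p hne).1 (not_le.2 (hout y hy))
      simp [this]
  have I2 : |∫ y in S, (φ1 y - ⟪gradient φ1 y, x - y⟫) ∂μH[2]| ≤ (B + B * t) * A := by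
    refine norm_setIntegral_le_of_eq_zero_off hmeas hfin (fun y hy => ?_) fun y hy => ?_
    · refine (abs_sub _ _).trans (add_le_add (hb1 y) ((abs_real_inner_le_norm _ _).trans ?_))
      rw [hnorm y hy]
      exact mul_le_mul_of_nonneg_right (hg1 y) ht.le
    · simp [hvan hs1 y (hout y hy), gradient_eq_zero_of_norm_gt hs1 (hout y hy)]
  have I3 : |∫ y in S, (2 * ⟪gradient φ0 y, x - y⟫ -
      ⟪fderiv ℝ (gradient φ0) y (x - y), x - y⟫) ∂μH[2]| ≤ (2 * (B * t) + B * t * t) * A := by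
    refine norm_setIntegral_le_of_eq_zero_off hmeas hfin (fun y hy => ?_) fun y hy => ?_
    · refine (abs_sub _ _).trans (add_le_add ?_ ((abs_real_inner_le_norm _ _).trans ?_))
      · rw [abs_mul, abs_two]
        refine mul_le_mul_of_nonneg_left ((abs_real_inner_le_norm _ _).trans ?_) zero_le_two
        rw [hnorm y hy]
        exact mul_le_mul_of_nonneg_right (hg0 y) ht.le
      · rw [hnorm y hy]
        refine mul_le_mul_of_nonneg_right ((ContinuousLinearMap.le_opNorm _ _).trans ?_) ht.le
        rw [hnorm y hy]
        exact mul_le_mul_of_nonneg_right (hH0 y) ht.le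
    · simp [gradient_eq_zero_of_norm_gt hs0 (hout y hy),
        fderiv_gradient_eq_zero_of_norm_gt hs0 (hout y hy)]
  have hπ : 1 ≤ 4 * π := by linarith [Real.pi_gt_three]
  have c2 : 1 / (4 * π * t ^ 2) ≤ 1 / t ^ 2 :=
    one_div_le_one_div_of_le (by positivity) (le_mul_of_one_le_left (by positivity) hπ)
  have c3 : 1 / (4 * π * t ^ 3) ≤ 1 / t ^ 3 :=
    one_div_le_one_div_of_le (by positivity) (le_mul_of_one_le_left (by positivity) hπ)
  have hD : |Dfun fin φ0 φ1 t x| ≤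
      1 / t * (M * A) + 1 / t ^ 2 * ((B + B * t) * A)
        + 1 / t ^ 3 * ((2 * (B * t) + B * t * t) * A) := by
    rw [Dfun]
    refine (abs_sub _ _).trans (add_le_add ((abs_add_le _ _).trans (add_le_add ?_ ?_)) ?_)
    · rw [abs_mul, abs_neg, abs_of_pos (by positivity)]
      exact mul_le_mul_of_nonneg_left I1 (by positivity)
    · rw [abs_mul, abs_of_pos (by positivity)]
      exact mul_le_mul c2 I2 (abs_nonneg _) (by positivity)
    · rw [abs_mul, abs_of_pos (by positivity)]
      exact mul_le_mul c3 I3 (abs_nonneg _) (by positivity)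
  have hxt : 0 < 1 + R + t - ‖x‖ := by linarith
  have hx0 := norm_nonneg x
  rw [mul_assoc, ← mul_inv, ← div_eq_mul_inv, le_div_iff₀ (by positivity)]
  rcases (S ∩ K).eq_empty_or_nonempty with hempty | ⟨y, hyS, hyK⟩
  · have hAz : A = 0 := by simp [A, hempty]
    rw [hAz] at hD
    simp only [mul_zero, add_zero] at hD
    calc |Dfun fin φ0 φ1 t x| * _ ≤ 0 * _ := mul_le_mul_of_nonneg_right hD (by positivity)
      _ ≤ _ := by rw [zero_mul]; positivity
  have htx : t ≤ ‖x‖ + R := by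
    rw [← hnorm y hyS]
    exact (norm_sub_le x y).trans (add_le_add_right (mem_closedBall_zero_iff.1 hyK) _)
  have hdecay : |Dfun fin φ0 φ1 t x| * (1 + t) ≤ (M + 4 * B) * (768 * (1 + R ^ 2)) := by
    have e1 : 1 / t * (M * A) + 1 / t ^ 2 * ((B + B * t) * A)
        + 1 / t ^ 3 * ((2 * (B * t) + B * t * t) * A) ≤ (M + 4 * B) * (A * (1 + t) / t ^ 2) := by
      rw [← sub_nonneg]
      have : (M + 4 * B) * (A * (1 + t) / t ^ 2) - (1 / t * (M * A) + 1 / t ^ 2 * ((B + B * t) * A)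
        + 1 / t ^ 3 * ((2 * (B * t) + B * t * t) * A)) = A * (M + B + 2 * B * t) / t ^ 2 := by
        field_simp
        ring
      rw [this]
      positivity
    have e2 : A * (1 + t) / t ^ 2 * (1 + t) ≤ 768 * (1 + R ^ 2) := by
      rw [div_mul_eq_mul_div, div_le_iff₀ (by positivity)]
      nlinarith [mul_nonneg hA0 (sq_nonneg (1 - t)), mul_le_mul_of_nonneg_right hAR (sq_nonneg t)]
    calc |Dfun fin φ0 φ1 t x| * (1 + t)
        ≤ (M + 4 * B) * (A * (1 + t) / t ^ 2) * (1 + t) :=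
          mul_le_mul_of_nonneg_right (hD.trans e1) (by positivity)
      _ = (M + 4 * B) * (A * (1 + t) / t ^ 2 * (1 + t)) := by ring
      _ ≤ _ := mul_le_mul_of_nonneg_left e2 (by positivity)
  have hw : (1 + R + t + ‖x‖) * (1 + R + t - ‖x‖) ≤ (1 + t) * (2 * (1 + R) * (1 + 2 * R)) := by
    calc _ ≤ (2 * (1 + R) * (1 + t)) * (1 + 2 * R) :=
          mul_le_mul (by nlinarith [mul_pos hR ht]) (by linarith) hxt.le (by positivity)
      _ = _ := by ring
  calc |Dfun fin φ0 φ1 t x| * _ ≤ |Dfun fin φ0 φ1 t x| * _ :=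
        mul_le_mul_of_nonneg_left hw (abs_nonneg _)
    _ = |Dfun fin φ0 φ1 t x| * (1 + t) * (2 * (1 + R) * (1 + 2 * R)) := by ring
    _ ≤ _ := mul_le_mul_of_nonneg_right hdecay (by positivity)
end
end

section
/- For every p ∈ ℝ³ and every ξ ∈ ℝ³ with |ξ| = 1, setting p̂ := p/√(1+|p|²), one has 1 + ξ·p̂ ≥ 1/(2(1+|p|²)). -/
open MeasureTheory Real Filter
open scoped RealInnerProductSpace ENNReal

noncomputable section

/-- for every `p ∈ ℝ³` and unit vector `ξ ∈ ℝ³`,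
`1 + ξ·p̂ ≥ 1/(2(1+|p|²))`. -/
theorem stmt6 (p ξ : E3) (hξ : ‖ξ‖ = 1) :
    1 / (2 * (1 + ‖p‖ ^ 2)) ≤ 1 + ⟪ξ, phat p⟫ := by
  have hN : 0 < 1 + ‖p‖ ^ 2 := by positivity
  have hc : ⟪ξ, p⟫ ^ 2 ≤ ‖p‖ ^ 2 := by
    have h := abs_real_inner_le_norm ξ p
    rw [hξ, one_mul] at h
    exact sq_le_sq.mpr (by rwa [abs_norm])
  have hu : ⟪ξ, phat p⟫ ^ 2 ≤ 1 - 1 / (1 + ‖p‖ ^ 2) := by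
    rw [phat, real_inner_smul_right, mul_pow, inv_pow, Real.sq_sqrt hN.le]
    calc (1 + ‖p‖ ^ 2)⁻¹ * ⟪ξ, p⟫ ^ 2 ≤ (1 + ‖p‖ ^ 2)⁻¹ * ‖p‖ ^ 2 := by gcongr
      _ = 1 - 1 / (1 + ‖p‖ ^ 2) := by field_simp; ring
  have ha : 1 / (2 * (1 + ‖p‖ ^ 2)) = 1 / (1 + ‖p‖ ^ 2) / 2 := by field_simp
  rw [ha]
  nlinarith [sq_nonneg (1 + ⟪ξ, phat p⟫)]
end
end
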